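/- For λ_0 = 1 and λ_1 = 2 (the two-dimensional Cesàro space ces_2^(2), with norm N(u,v) = (|u|² + ((|u| + |v|)/2)²)^{1/2}), the von Neumann–Jordan constant equals 1 + 1/√5, i.e., sup{ (N(x+y)² + N(x−y)²)/(2(N(x)² + N(y)²)) : x, y ∈ ℝ², (x,y) ≠ (0,0) } = 1 + 1/√5, and the James constant equals √(2 + 2/√5), i.e., sup{ min(N(x+y), N(x−y)) : N(x) = N(y) = 1 } = √(2 + 2/√5). -/

import Mathlib

/-- The norm of the two-dimensional Cesàro space `ces_2^(2)`. -/
noncomputable def Nces (u v : ℝ) : ℝ :=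
  Real.sqrt (|u| ^ 2 + ((|u| + |v|) / 2) ^ 2)

theorem Nces_nonneg (u v : ℝ) : 0 ≤ Nces u v := Real.sqrt_nonneg _

theorem Nces_sq (u v : ℝ) : Nces u v ^ 2 = (5 * u ^ 2 + v ^ 2 + 2 * |u * v|) / 4 := by
  rw [Nces, Real.sq_sqrt (by positivity), abs_mul, ← sq_abs u, ← sq_abs v]
  ring

theorem one_div_sqrt_five : 1 / Real.sqrt 5 = Real.sqrt 5 / 5 := by
  have h : Real.sqrt 5 ^ 2 = 5 := Real.sq_sqrt (by norm_num)
  field_simp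
  linarith

theorem abs_add_mul_add_abs_sub_mul_le (a b c d : ℝ) :
    |(a + c) * (b + d)| + |(a - c) * (b - d)| ≤
      2 * max (|a * b| + |c * d|) (|a * d| + |c * b|) := by
  have h₁ := le_max_left (|a * b| + |c * d|) (|a * d| + |c * b|)
  have h₂ := le_max_right (|a * b| + |c * d|) (|a * d| + |c * b|)
  have := le_abs_self (a * b)
  have := neg_abs_le (a * b)
  have := le_abs_self (c * d)
  have := neg_abs_le (c * d)
  have := le_abs_self (a * d)
  have := neg_abs_le (a * d)
  have := le_abs_self (c * b)
  have := neg_abs_le (c * b)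
  rcases abs_cases ((a + c) * (b + d)) with ⟨h, -⟩ | ⟨h, -⟩ <;>
  rcases abs_cases ((a - c) * (b - d)) with ⟨h', -⟩ | ⟨h', -⟩ <;>
  rw [h, h'] <;> linarith

theorem two_mul_abs_mul_le (a d : ℝ) :
    2 * |a * d| ≤ Real.sqrt 5 / 5 * (5 * a ^ 2 + d ^ 2) := by
  have h : Real.sqrt 5 ^ 2 = 5 := Real.sq_sqrt (by norm_num)
  have h₀ : 0 ≤ Real.sqrt 5 := Real.sqrt_nonneg 5
  rw [abs_mul, ← sq_abs a, ← sq_abs d]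
  have key : Real.sqrt 5 / 5 * (5 * |a| ^ 2 + |d| ^ 2) - 2 * (|a| * |d|) =
      Real.sqrt 5 / 5 * (Real.sqrt 5 * |a| - |d|) ^ 2 := by
    linear_combination (-(Real.sqrt 5) / 5 * |a| ^ 2 + 2 / 5 * |a| * |d|) * h
  have : 0 ≤ Real.sqrt 5 / 5 * (Real.sqrt 5 * |a| - |d|) ^ 2 := by positivity
  linarith

theorem Nces_parallelogram_le (a b c d : ℝ) :
    Nces (a + c) (b + d) ^ 2 + Nces (a - c) (b - d) ^ 2 ≤
      (1 + Real.sqrt 5 / 5) * (2 * (Nces a b ^ 2 + Nces c d ^ 2)) := by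
  simp only [Nces_sq]
  have h := abs_add_mul_add_abs_sub_mul_le a b c d
  have h₁ := two_mul_abs_mul_le a d
  have h₂ := two_mul_abs_mul_le c b
  have h₃ : 0 ≤ Real.sqrt 5 / 5 * (|a * b| + |c * d|) := by positivity
  have h₄ : 0 ≤ Real.sqrt 5 / 5 * (5 * (a ^ 2 + c ^ 2) + b ^ 2 + d ^ 2) := by positivity
  have h₅ := abs_nonneg (a * b)
  have h₆ := abs_nonneg (c * d)
  rcases max_cases (|a * b| + |c * d|) (|a * d| + |c * b|) with ⟨e, -⟩ | ⟨e, -⟩ <;>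
  rw [e] at h <;> nlinarith

theorem Nces_sq_add_sq_pos {a b c d : ℝ} (h : ¬(a = 0 ∧ b = 0 ∧ c = 0 ∧ d = 0)) :
    0 < Nces a b ^ 2 + Nces c d ^ 2 := by
  simp only [Nces_sq]
  by_contra! hle
  have := abs_nonneg (a * b)
  have := abs_nonneg (c * d)
  refine h ⟨?_, ?_, ?_, ?_⟩ <;> refine pow_eq_zero_iff two_ne_zero |>.1 ?_ <;>
    linarith [sq_nonneg a, sq_nonneg b, sq_nonneg c, sq_nonneg d]

/-- For `ces_2^(2)` the von Neumann–Jordan constant equals `1 + 1/√5` and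
the James constant equals `√(2 + 2/√5)`. -/
theorem ces2_constants :
    sSup {r : ℝ | ∃ a b c d : ℝ, ¬(a = 0 ∧ b = 0 ∧ c = 0 ∧ d = 0) ∧
      r = ((Nces (a + c) (b + d)) ^ 2 + (Nces (a - c) (b - d)) ^ 2) /
        (2 * ((Nces a b) ^ 2 + (Nces c d) ^ 2))} = 1 + 1 / Real.sqrt 5 ∧
    sSup {r : ℝ | ∃ a b c d : ℝ, Nces a b = 1 ∧ Nces c d = 1 ∧
      r = min (Nces (a + c) (b + d)) (Nces (a - c) (b - d))} =
      Real.sqrt (2 + 2 / Real.sqrt 5) := by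
  have hs : Real.sqrt 5 ^ 2 = 5 := Real.sq_sqrt (by norm_num)
  have hs₀ : 0 ≤ Real.sqrt 5 := Real.sqrt_nonneg 5
  have e₁ : Nces (2 / 5 * Real.sqrt 5) 0 = 1 := by
    rw [← sq_eq_sq₀ (Nces_nonneg _ _) zero_le_one, Nces_sq]
    simp only [mul_zero, abs_zero]
    linarith
  have e₂ : Nces 0 2 = 1 := by
    rw [← sq_eq_sq₀ (Nces_nonneg _ _) zero_le_one, Nces_sq]
    norm_num
  have e₃ : Nces (2 / 5 * Real.sqrt 5 + 0) (0 + 2) ^ 2 = 2 + 2 * (Real.sqrt 5 / 5) := by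
    rw [Nces_sq, abs_of_nonneg (by positivity)]
    linarith
  have e₄ : Nces (2 / 5 * Real.sqrt 5 - 0) (0 - 2) ^ 2 = 2 + 2 * (Real.sqrt 5 / 5) := by
    rw [Nces_sq, abs_of_nonpos (by linarith)]
    linarith
  have hd : 2 / Real.sqrt 5 = 2 * (Real.sqrt 5 / 5) := by
    rw [← one_div_sqrt_five]
    ring
  rw [hd, one_div_sqrt_five]
  constructor
  · refine IsGreatest.csSup_eq ⟨⟨2 / 5 * Real.sqrt 5, 0, 0, 2, by norm_num, ?_⟩, ?_⟩
    · rw [e₁, e₂, e₃, e₄]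
      ring
    · rintro r ⟨a, b, c, d, h, rfl⟩
      have := Nces_sq_add_sq_pos h
      rw [div_le_iff₀ (by positivity)]
      exact Nces_parallelogram_le a b c d
  · refine IsGreatest.csSup_eq ⟨⟨2 / 5 * Real.sqrt 5, 0, 0, 2, e₁, e₂, ?_⟩, ?_⟩
    · rw [← e₃, Real.sqrt_sq (Nces_nonneg _ _), eq_comm, min_eq_left]
      exact (pow_le_pow_iff_left₀ (Nces_nonneg _ _) (Nces_nonneg _ _) two_ne_zero).1
        (e₃.trans e₄.symm).le
    · rintro r ⟨a, b, c, d, h₁, h₂, rfl⟩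
      have h := Nces_parallelogram_le a b c d
      rw [h₁, h₂] at h
      have hm := le_min (Nces_nonneg (a + c) (b + d)) (Nces_nonneg (a - c) (b - d))
      have hl := pow_le_pow_left₀ hm (min_le_left _ _) 2
      have hr := pow_le_pow_left₀ hm (min_le_right _ _) 2
      exact Real.le_sqrt_of_sq_le (by linarith)
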